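/- arXiv:1704.02607 — 4 statements merged into one kernel-verified Lean document; each statement's English description precedes it below -/
import Mathlib

section
/- Suppose A_1, …, A_r are stable and A_{r+1}, …, A_k are unstable (1 ≤ r < k), and suppose the subgraph G_u of G with edge set {(i,j) ∈ E(G) : i ∈ {r+1,…,k}} is acyclic. Then there exist τ_0 ≥ 0 and η_0 > 0 such that for every τ > τ_0 and every η with 0 < η < η_0, the switched system is asymptotically stable for every signal σ ∈ S_G(τ, η). -/
open Matrix Filter Topology Finset

attribute [local instance] Classical.propDecidable

noncomputable section

/-- The spectral (ℓ² operator) norm of a complex square matrix. -/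
def sNorm {n : ℕ} (M : Matrix (Fin n) (Fin n) ℂ) : ℝ :=
  ‖Matrix.toEuclideanCLM (𝕜 := ℂ) M‖

/-- The spectral (ℓ² operator) norm of a real square matrix. -/
def sNormR {n : ℕ} (M : Matrix (Fin n) (Fin n) ℝ) : ℝ :=
  ‖Matrix.toEuclideanCLM (𝕜 := ℝ) M‖

/-- The ordered product `exp(A_{σ_m}(t_m - t_{m-1})) ⋯ exp(A_{σ_1} t_1)` of the switched
system (0-based: `flow A t v m = exp((t m - t (m-1)) • A (v (m-1))) * ⋯ * exp((t 1 - t 0) • A (v 0))`). -/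
def flow {n k : ℕ} (A : Fin k → Matrix (Fin n) (Fin n) ℝ)
    (t : ℕ → ℝ) (v : ℕ → Fin k) : ℕ → Matrix (Fin n) (Fin n) ℝ
  | 0 => 1
  | m + 1 => NormedSpace.exp ((t (m + 1) - t m) • A (v m)) * flow A t v m

/-- Piecewise evaluation: the value `f m` on the interval `[t m, t (m+1))`. -/
def pc {α : Type*} (t : ℕ → ℝ) (f : ℕ → α) (d : α) (s : ℝ) : α :=
  if h : ∃ m, t m ≤ s ∧ s < t (m + 1) then f h.choose else d

/-- The solution of the switched system `x' = A_{σ(t)} x`, `x(0) = x0`: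
for `s ∈ [t m, t (m+1))`, `x(s) = exp((s - t m) • A (v m)) * flow A t v m * x0`. -/
def sol {n k : ℕ} (A : Fin k → Matrix (Fin n) (Fin n) ℝ)
    (t : ℕ → ℝ) (v : ℕ → Fin k) (x0 : EuclideanSpace ℝ (Fin n)) (s : ℝ) :
    EuclideanSpace ℝ (Fin n) :=
  pc t (fun m => Matrix.toEuclideanCLM (𝕜 := ℝ)
    (NormedSpace.exp ((s - t m) • A (v m)) * flow A t v m) x0) 0 s

/-- A `G`-admissible switching signal: `t 0 = 0`, strictly increasing switching times tending
to infinity, and consecutive vertices joined by edges of `G`.  Here `v m` is the vertex active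
on `[t m, t (m+1))` (i.e. `v m = σ_{m+1}` in 1-based notation). -/
def Admissible {k : ℕ} (E : Set (Fin k × Fin k)) (t : ℕ → ℝ) (v : ℕ → Fin k) : Prop :=
  t 0 = 0 ∧ StrictMono t ∧ Tendsto t atTop atTop ∧ ∀ m, (v m, v (m + 1)) ∈ E

/-- A real matrix is stable if all its (complex) eigenvalues have negative real part. -/
def MStable {n : ℕ} (M : Matrix (Fin n) (Fin n) ℝ) : Prop :=
  ∀ z ∈ spectrum ℂ (M.map (Complex.ofReal)), z.re < 0

/-- A real matrix is unstable if some eigenvalue has positive real part and no eigenvalue has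
zero real part. -/
def MUnstable {n : ℕ} (M : Matrix (Fin n) (Fin n) ℝ) : Prop :=
  (∃ z ∈ spectrum ℂ (M.map (Complex.ofReal)), 0 < z.re) ∧
    ∀ z ∈ spectrum ℂ (M.map (Complex.ofReal)), z.re ≠ 0

/-- `a` is the maximum of the real parts of the eigenvalues of `M`. -/
def MaxRe {n : ℕ} (M : Matrix (Fin n) (Fin n) ℝ) (a : ℝ) : Prop :=
  IsGreatest (Complex.re '' spectrum ℂ (M.map (Complex.ofReal))) a

/-- `M = P D P⁻¹` with `P` invertible and `D` diagonal (diagonalizability over `ℂ`). -/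
def Diagonalized {n : ℕ} (M : Matrix (Fin n) (Fin n) ℝ)
    (P D : Matrix (Fin n) (Fin n) ℂ) : Prop :=
  IsUnit P ∧ D.IsDiag ∧ M.map (Complex.ofReal) = P * D * P⁻¹

/-- Asymptotic stability of the switched system for the given signal. -/
def AsympStable {n k : ℕ} (A : Fin k → Matrix (Fin n) (Fin n) ℝ)
    (t : ℕ → ℝ) (v : ℕ → Fin k) : Prop :=
  ∀ x0 : EuclideanSpace ℝ (Fin n), Tendsto (fun s => ‖sol A t v x0 s‖) atTop (𝓝 0)

/-- Membership in the class `S_G(τ, η)`: dwell time at least `τ` in the stable subsystems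
(indices `< r`), flee time at most `η` in the unstable subsystems (indices `≥ r`). -/
def InSG {k : ℕ} (r : ℕ) (τ η : ℝ) (t : ℕ → ℝ) (v : ℕ → Fin k) : Prop :=
  ∀ m, ((v m).1 < r → τ ≤ t (m + 1) - t m) ∧ (r ≤ (v m).1 → t (m + 1) - t m ≤ η)

end

/-- A digraph (given by its edge set) is acyclic if it contains no directed closed path. -/
def AcyclicS {k : ℕ} (E : Set (Fin k × Fin k)) : Prop :=
  ¬∃ (m : ℕ) (w : ℕ → Fin k), 0 < m ∧ (∀ j < m, (w j, w (j + 1)) ∈ E) ∧ w m = w 0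

theorem aux_map_exp {n : ℕ} (M : Matrix (Fin n) (Fin n) ℝ) :
    (NormedSpace.exp M).map Complex.ofReal = NormedSpace.exp (M.map Complex.ofReal) := by
  open scoped Matrix.Norms.Operator in
  exact NormedSpace.map_exp (Complex.ofRealHom.mapMatrix (m := Fin n))
    (Continuous.matrix_map continuous_id Complex.continuous_ofReal) M

theorem aux_norm_le {n : ℕ} (M : Matrix (Fin n) (Fin n) ℝ) (c : ℝ)
    (h : ∀ i j, |M i j| ≤ c) :
    sNormR M ≤ c * ∑ i, ∑ j, sNormR (Matrix.single i j (1 : ℝ) : Matrix (Fin n) (Fin n) ℝ) := by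
  unfold sNormR
  conv_lhs => rw [matrix_eq_sum_single M]
  rw [map_sum, Finset.mul_sum]
  refine (norm_sum_le _ _).trans (Finset.sum_le_sum fun i _ => ?_)
  rw [map_sum, Finset.mul_sum]
  refine (norm_sum_le _ _).trans (Finset.sum_le_sum fun j _ => ?_)
  have : (Matrix.single i j (M i j) : Matrix (Fin n) (Fin n) ℝ)
      = M i j • Matrix.single i j (1 : ℝ) := by simp
  rw [this, map_smul, norm_smul, Real.norm_eq_abs]
  exact mul_le_mul_of_nonneg_right (h i j) (norm_nonneg _)

theorem aux_exp_bound {n : ℕ} (M : Matrix (Fin n) (Fin n) ℝ) (P D : Matrix (Fin n) (Fin n) ℂ)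
    (h : Diagonalized M P D) (μ : ℝ) (hμ : ∀ l, (D l l).re ≤ μ) :
    ∃ K : ℝ, 0 ≤ K ∧ ∀ s : ℝ, 0 ≤ s → sNormR (NormedSpace.exp (s • M)) ≤ K * Real.exp (μ * s) := by
  obtain ⟨hP, hD, hM⟩ := h
  set Q : ℝ := ∑ i, ∑ j, ∑ l, ‖P i l‖ * ‖P⁻¹ l j‖ with hQ
  set S : ℝ := ∑ i, ∑ j, sNormR (Matrix.single i j (1 : ℝ) : Matrix (Fin n) (Fin n) ℝ) with hS
  have hQ0 : 0 ≤ Q := by positivity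
  have hS0 : 0 ≤ S := Finset.sum_nonneg fun i _ => Finset.sum_nonneg fun j _ => norm_nonneg _
  refine ⟨Q * S, by positivity, fun s hs => ?_⟩
  have key : (NormedSpace.exp (s • M)).map Complex.ofReal
      = P * Matrix.diagonal (fun l => Complex.exp (s * D l l)) * P⁻¹ := by
    rw [aux_map_exp]
    have h1 : (s • M).map Complex.ofReal
        = P * Matrix.diagonal (fun l => (s : ℂ) * D l l) * P⁻¹ := by
      have h2 : (s • M).map Complex.ofReal = (s : ℂ) • M.map Complex.ofReal := by
        ext i j; simp
      have h3 : Matrix.diagonal (fun l => (s : ℂ) * D l l) = (s : ℂ) • D := by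
        conv_rhs => rw [← hD.diagonal_diag]
        rw [← Matrix.diagonal_smul]; rfl
      rw [h2, hM, h3]; simp
    rw [h1, Matrix.exp_conj _ _ hP, Matrix.exp_diagonal]
    congr 3
    ext l
    rw [Pi.coe_exp, Complex.exp_eq_exp_ℂ]
  have hent : ∀ i j, |NormedSpace.exp (s • M) i j| ≤ Q * Real.exp (μ * s) := by
    intro i j
    have e1 : ((NormedSpace.exp (s • M) i j : ℝ) : ℂ)
        = ∑ l, P i l * Complex.exp (s * D l l) * P⁻¹ l j := by
      have := congrFun (congrFun key i) j
      simpa [Matrix.mul_apply, Matrix.diagonal_apply] using this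
    have e2 : |NormedSpace.exp (s • M) i j| = ‖((NormedSpace.exp (s • M) i j : ℝ) : ℂ)‖ := by simp
    rw [e2, e1]
    calc ‖∑ l, P i l * Complex.exp (s * D l l) * P⁻¹ l j‖
        ≤ ∑ l, ‖P i l‖ * ‖P⁻¹ l j‖ * Real.exp (μ * s) := by
          refine (norm_sum_le _ _).trans (Finset.sum_le_sum fun l _ => ?_)
          rw [norm_mul, norm_mul, Complex.norm_exp]
          have : ((s : ℂ) * D l l).re ≤ μ * s := by
            simp only [Complex.re_ofReal_mul]
            nlinarith [hμ l]
          have := Real.exp_le_exp.2 this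
          rw [mul_right_comm]
          gcongr
      _ = (∑ l, ‖P i l‖ * ‖P⁻¹ l j‖) * Real.exp (μ * s) := by rw [Finset.sum_mul]
      _ ≤ Q * Real.exp (μ * s) := by
          gcongr
          calc (∑ l, ‖P i l‖ * ‖P⁻¹ l j‖) ≤ ∑ j, ∑ l, ‖P i l‖ * ‖P⁻¹ l j‖ :=
                Finset.single_le_sum (f := fun j => ∑ l, ‖P i l‖ * ‖P⁻¹ l j‖)
                  (fun _ _ => by positivity) (Finset.mem_univ j)
            _ ≤ Q := Finset.single_le_sum (f := fun i => ∑ j, ∑ l, ‖P i l‖ * ‖P⁻¹ l j‖)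
                  (fun _ _ => by positivity) (Finset.mem_univ i)
  refine (aux_norm_le _ _ hent).trans (le_of_eq ?_)
  ring

theorem aux_mem_spec {n : ℕ} (M : Matrix (Fin n) (Fin n) ℝ) (P D : Matrix (Fin n) (Fin n) ℂ)
    (h : Diagonalized M P D) (l : Fin n) : D l l ∈ spectrum ℂ (M.map Complex.ofReal) := by
  obtain ⟨⟨u, rfl⟩, hD, hM⟩ := h
  rw [hM, ← Matrix.coe_units_inv, spectrum.units_conjugate, ← hD.diagonal_diag,
    spectrum_diagonal]
  exact ⟨l, by simp⟩

theorem aux_stable {n : ℕ} (M : Matrix (Fin n) (Fin n) ℝ) (P D : Matrix (Fin n) (Fin n) ℂ)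
    (h : Diagonalized M P D) (hs : MStable M) :
    ∃ K μ : ℝ, 0 ≤ K ∧ 0 < μ ∧
      ∀ s : ℝ, 0 ≤ s → sNormR (NormedSpace.exp (s • M)) ≤ K * Real.exp (-μ * s) := by
  have : ∃ μ : ℝ, 0 < μ ∧ ∀ l, (D l l).re ≤ -μ := by
    rcases isEmpty_or_nonempty (Fin n) with he | he
    · exact ⟨1, one_pos, fun l => (he.false l).elim⟩
    · obtain ⟨l0, h0⟩ := Finite.exists_max (fun l => (D l l).re)
      refine ⟨-(D l0 l0).re, ?_, fun l => by simpa using h0 l⟩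
      have := hs _ (aux_mem_spec M P D h l0)
      linarith
  obtain ⟨μ, hμ, hl⟩ := this
  obtain ⟨K, hK, hb⟩ := aux_exp_bound M P D h (-μ) hl
  exact ⟨K, μ, hK, hμ, hb⟩

theorem aux_any {n : ℕ} (M : Matrix (Fin n) (Fin n) ℝ) (P D : Matrix (Fin n) (Fin n) ℂ)
    (h : Diagonalized M P D) :
    ∃ K : ℝ, 0 ≤ K ∧
      ∀ s : ℝ, 0 ≤ s → s ≤ 1 → sNormR (NormedSpace.exp (s • M)) ≤ K := by
  set μ : ℝ := ∑ l, |(D l l).re| with hμ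
  have hμ0 : 0 ≤ μ := by positivity
  obtain ⟨K, hK, hb⟩ := aux_exp_bound M P D h μ (fun l => (le_abs_self _).trans
    (Finset.single_le_sum (f := fun l => |(D l l).re|) (fun _ _ => abs_nonneg _)
      (Finset.mem_univ l)))
  refine ⟨K * Real.exp μ, by positivity, fun s h0 h1 => (hb s h0).trans ?_⟩
  gcongr
  nlinarith

theorem aux_run {k : ℕ} (E : Set (Fin k × Fin k)) (r : ℕ)
    (hacyc : AcyclicS {e ∈ E | r ≤ e.1.1}) (v : ℕ → Fin k)
    (hv : ∀ m, (v m, v (m + 1)) ∈ E) (m : ℕ) : ∃ j < k + 1, (v (m + j)).1 < r := by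
  by_contra! hcon
  obtain ⟨a, b, hab, heq⟩ := Fintype.exists_ne_map_eq_of_card_lt
    (fun j : Fin (k + 1) => v (m + j)) (by simp)
  wlog hlt : a < b generalizing a b
  · exact this b a hab.symm heq.symm (lt_of_le_of_ne (not_lt.1 hlt) hab.symm)
  have hlt' : a.1 < b.1 := hlt
  refine hacyc ⟨b.1 - a.1, fun j => v (m + a.1 + j), by omega, fun j hj => ⟨hv _, ?_⟩, ?_⟩
  · have := hcon (a.1 + j) (by omega)
    simpa [add_assoc] using this
  · have : m + a.1 + (b.1 - a.1) = m + b.1 := by omega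
    simp only [this, add_zero]
    exact heq.symm

theorem aux_seq (a : ℕ → ℝ) (C : ℝ) (hC : 1 ≤ C) (L : ℕ) (hL : 0 < L) (h0 : ∀ m, 0 ≤ a m)
    (hpow : ∀ m j, a (m + j) ≤ C ^ j * a m) (hhalf : ∀ m, a (m + L) ≤ 1 / 2 * a m) :
    Tendsto a atTop (𝓝 0) := by
  have hq : ∀ q, a (q * L) ≤ (1 / 2) ^ q * a 0 := by
    intro q
    induction q with
    | zero => simp
    | succ q ih =>
      rw [Nat.succ_mul]
      refine (hhalf _).trans ?_
      rw [pow_succ]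
      linarith
  have hb : ∀ m, a m ≤ C ^ L * ((1 / 2) ^ (m / L) * a 0) := by
    intro m
    have h1 := hpow (m / L * L) (m % L)
    rw [Nat.div_add_mod'] at h1
    refine h1.trans ?_
    have : C ^ (m % L) ≤ C ^ L := pow_le_pow_right₀ hC (Nat.mod_lt _ hL).le
    have h3 := hq (m / L)
    have h4 := h0 (m / L * L)
    gcongr
  have hlim : Tendsto (fun m : ℕ => C ^ L * ((1 / 2 : ℝ) ^ (m / L) * a 0)) atTop (𝓝 0) := by
    have h1 : Tendsto (fun m : ℕ => (1 / 2 : ℝ) ^ (m / L)) atTop (𝓝 0) :=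
      (tendsto_pow_atTop_nhds_zero_of_lt_one (by norm_num) (by norm_num)).comp
        (Nat.tendsto_div_const_atTop hL.ne')
    simpa using (h1.mul_const (a 0)).const_mul (C ^ L)
  exact squeeze_zero h0 hb hlim

/-- if the unstable subgraph `G_u` (edges with source of index `≥ r`) is
acyclic, then there are `τ₀ ≥ 0` and `η₀ > 0` such that for every dwell time `τ > τ₀` and
flee time `0 < η < η₀` the switched system is asymptotically stable for every signal in
`S_G(τ, η)`. -/
theorem stability_of_acyclic_unstable_part {n k : ℕ} (E : Set (Fin k × Fin k))
    (r : ℕ) (hr : 1 ≤ r) (hrk : r < k)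
    (A : Fin k → Matrix (Fin n) (Fin n) ℝ) (P D : Fin k → Matrix (Fin n) (Fin n) ℂ)
    (hdiag : ∀ i, Diagonalized (A i) (P i) (D i))
    (hstab : ∀ i : Fin k, i.1 < r → MStable (A i))
    (hunst : ∀ i : Fin k, r ≤ i.1 → MUnstable (A i))
    (hacyc : AcyclicS {e ∈ E | r ≤ e.1.1}) :
    ∃ τ₀ η₀ : ℝ, 0 ≤ τ₀ ∧ 0 < η₀ ∧
      ∀ τ η : ℝ, τ₀ < τ → 0 < η → η < η₀ →
        ∀ (t : ℕ → ℝ) (v : ℕ → Fin k), Admissible E t v → InSG r τ η t v →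
          AsympStable A t v := by
  have hK1 : ∀ i, ∃ K : ℝ, 0 ≤ K ∧
      ∀ s : ℝ, 0 ≤ s → s ≤ 1 → sNormR (NormedSpace.exp (s • A i)) ≤ K :=
    fun i => aux_any _ _ _ (hdiag i)
  have hK2 : ∀ i : Fin k, ∃ K μ : ℝ, 0 ≤ K ∧ 0 < μ ∧ (i.1 < r →
      ∀ s : ℝ, 0 ≤ s → sNormR (NormedSpace.exp (s • A i)) ≤ K * Real.exp (-μ * s)) := by
    intro i
    by_cases hi : i.1 < r
    · obtain ⟨K, μ, h1, h2, h3⟩ := aux_stable _ _ _ (hdiag i) (hstab i hi)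
      exact ⟨K, μ, h1, h2, fun _ => h3⟩
    · exact ⟨1, 1, zero_le_one, one_pos, fun h => absurd h hi⟩
  choose K1 hK1n hK1b using hK1
  choose K2 mu hK2n hmu hK2b using hK2
  set C : ℝ := 1 + ∑ i, K1 i + ∑ i, K2 i with hCdef
  have hs1 : 0 ≤ ∑ i, K1 i := Finset.sum_nonneg fun i _ => hK1n i
  have hs2 : 0 ≤ ∑ i, K2 i := Finset.sum_nonneg fun i _ => hK2n i
  have hC : 1 ≤ C := by linarith
  have hC1 : ∀ i, K1 i ≤ C := fun i => by
    have := Finset.single_le_sum (f := K1) (fun i _ => hK1n i) (Finset.mem_univ i)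
    linarith
  have hC2 : ∀ i, K2 i ≤ C := fun i => by
    have := Finset.single_le_sum (f := K2) (fun i _ => hK2n i) (Finset.mem_univ i)
    linarith
  have : Nonempty (Fin k) := ⟨⟨r, hrk⟩⟩
  obtain ⟨i0, hi0⟩ := Finite.exists_min mu
  set lam := mu i0 with hlam
  have hlam0 : 0 < lam := hmu i0
  have hCL : (0 : ℝ) < 2 * C ^ (k + 1) := by positivity
  have hCL1 : (1 : ℝ) ≤ 2 * C ^ (k + 1) := by
    have := one_le_pow₀ hC (n := k + 1)
    linarith
  refine ⟨Real.log (2 * C ^ (k + 1)) / lam, 1,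
    div_nonneg (Real.log_nonneg hCL1) hlam0.le, one_pos, ?_⟩
  intro τ η hτ hη hη1 t v hadm hsg x0
  obtain ⟨ht0, htm, htt, hE⟩ := hadm
  have hτ0 : 0 < τ := (div_nonneg (Real.log_nonneg hCL1) hlam0.le).trans_lt hτ
  have hdec : C ^ (k + 1) * Real.exp (-lam * τ) ≤ 1 / 2 := by
    have h1 : Real.log (2 * C ^ (k + 1)) ≤ lam * τ := by
      rw [div_lt_iff₀ hlam0] at hτ
      linarith
    have h2 : 2 * C ^ (k + 1) ≤ Real.exp (lam * τ) := by
      rw [← Real.exp_log hCL]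
      exact Real.exp_le_exp.2 h1
    have h3 : Real.exp (lam * τ) * Real.exp (-lam * τ) = 1 := by
      rw [← Real.exp_add]; simp
    have h4 := mul_le_mul_of_nonneg_right h2 (Real.exp_pos (-lam * τ)).le
    linarith
  have hone : ∀ m s, 0 ≤ s → s ≤ t (m + 1) - t m →
      sNormR (NormedSpace.exp (s • A (v m))) ≤ C := by
    intro m s h0 h1
    by_cases hi : (v m).1 < r
    · refine (hK2b (v m) hi s h0).trans ?_
      have : Real.exp (-mu (v m) * s) ≤ 1 := by
        rw [Real.exp_le_one_iff]
        have := mul_nonneg (hmu (v m)).le h0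
        linarith
      have h5 := mul_le_mul_of_nonneg_left this (hK2n (v m))
      linarith [hC2 (v m)]
    · have h2 := (hsg m).2 (not_lt.1 hi)
      exact (hK1b (v m) s h0 (by linarith)).trans (hC1 _)
  have hstb : ∀ m, (v m).1 < r →
      sNormR (NormedSpace.exp ((t (m + 1) - t m) • A (v m))) ≤ C * Real.exp (-lam * τ) := by
    intro m hi
    have h1 := (hsg m).1 hi
    refine (hK2b (v m) hi _ (by linarith)).trans ?_
    have h2 : -mu (v m) * (t (m + 1) - t m) ≤ -lam * τ := by
      have := mul_le_mul (hi0 (v m)) h1 hτ0.le (hmu (v m)).le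
      linarith
    have h3 := Real.exp_le_exp.2 h2
    exact mul_le_mul (hC2 _) h3 (Real.exp_pos _).le (by linarith)
  set a : ℕ → ℝ := fun m => ‖Matrix.toEuclideanCLM (𝕜 := ℝ) (flow A t v m) x0‖ with ha
  have ha0 : ∀ m, 0 ≤ a m := fun m => norm_nonneg _
  have hmul : ∀ (M : Matrix (Fin n) (Fin n) ℝ) m,
      ‖Matrix.toEuclideanCLM (𝕜 := ℝ) (M * flow A t v m) x0‖ ≤ sNormR M * a m := by
    intro M m
    rw [map_mul]
    exact (Matrix.toEuclideanCLM (𝕜 := ℝ) M).le_opNorm (Matrix.toEuclideanCLM (𝕜 := ℝ) (flow A t v m) x0)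
  have hstep : ∀ m, a (m + 1) ≤ C * a m := by
    intro m
    have h1 := htm (Nat.lt_succ_self m)
    refine (hmul _ m).trans ?_
    exact mul_le_mul_of_nonneg_right (hone m _ (by linarith) le_rfl) (ha0 m)
  have hsteps : ∀ m, (v m).1 < r → a (m + 1) ≤ C * Real.exp (-lam * τ) * a m := by
    intro m hi
    refine (hmul _ m).trans ?_
    exact mul_le_mul_of_nonneg_right (hstb m hi) (ha0 m)
  have hpow : ∀ m j, a (m + j) ≤ C ^ j * a m := by
    intro m j
    induction j with
    | zero => simp
    | succ j ih =>
      have h1 := hstep (m + j)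
      rw [add_assoc] at h1
      refine h1.trans ?_
      rw [pow_succ', mul_assoc]
      exact mul_le_mul_of_nonneg_left ih (by linarith)
  have hhalf : ∀ m, a (m + (k + 1)) ≤ 1 / 2 * a m := by
    intro m
    obtain ⟨j, hj, hi⟩ := aux_run E r hacyc v hE m
    obtain ⟨p, hp⟩ : ∃ p, k + 1 = j + 1 + p := ⟨k + 1 - (j + 1), by omega⟩
    have h1 := hpow m j
    have h2 := hsteps (m + j) hi
    have h3 := hpow (m + j + 1) p
    have hidx : m + (k + 1) = m + j + 1 + p := by omega
    rw [hidx]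
    have hC0 : 0 ≤ C := by linarith
    calc a (m + j + 1 + p) ≤ C ^ p * a (m + j + 1) := h3
      _ ≤ C ^ p * (C * Real.exp (-lam * τ) * (C ^ j * a m)) := by
          refine mul_le_mul_of_nonneg_left (h2.trans ?_) (by positivity)
          exact mul_le_mul_of_nonneg_left h1 (by positivity)
      _ = C ^ (k + 1) * Real.exp (-lam * τ) * a m := by rw [hp]; ring
      _ ≤ 1 / 2 * a m := mul_le_mul_of_nonneg_right hdec (ha0 m)
  have hlim := aux_seq a C hC (k + 1) (Nat.succ_pos k) ha0 hpow hhalf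
  rw [Metric.tendsto_atTop]
  intro ε hε
  have hlim2 : Tendsto (fun m => C * a m) atTop (𝓝 0) := by
    simpa using hlim.const_mul C
  obtain ⟨N, hN⟩ := Filter.eventually_atTop.1 (hlim2.eventually_lt_const hε)
  refine ⟨t N, fun s hs => ?_⟩
  rw [Real.dist_eq, sub_zero, abs_of_nonneg (norm_nonneg _)]
  unfold sol pc
  split_ifs with h
  · obtain ⟨hm1, hm2⟩ := h.choose_spec
    set m := h.choose with hm
    have hNm : N ≤ m := by
      have := htm.lt_iff_lt.1 (lt_of_le_of_lt hs hm2)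
      omega
    refine lt_of_le_of_lt ((hmul _ m).trans ?_) (hN m hNm)
    exact mul_le_mul_of_nonneg_right (hone m _ (by linarith) (by linarith)) (ha0 m)
  · simpa using hε
end

section
/- Let m ≥ 1, and for each j ∈ {1, …, m} let P_j be an invertible complex n×n matrix, D_j a complex diagonal n×n matrix all of whose diagonal entries have real part at most −λ_j (λ_j ∈ ℝ), and δ_j ≥ 0. Then the ordered product satisfies ‖P_m e^{D_m δ_m} P_m⁻¹ · P_{m−1} e^{D_{m−1} δ_{m−1}} P_{m−1}⁻¹ ⋯ P_1 e^{D_1 δ_1} P_1⁻¹‖ ≤ ‖P_m‖ · ‖P_1⁻¹‖ · ( Π_{j=1}^{m−1} ‖P_{j+1}⁻¹ P_j‖ ) · Π_{j=1}^{m} e^{−λ_j δ_j}. -/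
open Matrix Filter Topology Finset

attribute [local instance] Classical.propDecidable

/-- The descending ordered product `F m * F (m-1) * ⋯ * F 1`. -/
noncomputable def prodDesc {n : ℕ} (F : ℕ → Matrix (Fin n) (Fin n) ℂ) : ℕ → Matrix (Fin n) (Fin n) ℂ
  | 0 => 1
  | m + 1 => F (m + 1) * prodDesc F m

theorem sNorm_mul_le_aux {n : ℕ} (A B : Matrix (Fin n) (Fin n) ℂ) :
    sNorm (A * B) ≤ sNorm A * sNorm B := by
  unfold sNorm
  rw [map_mul]
  exact norm_mul_le _ _

theorem sNorm_nonneg_aux {n : ℕ} (A : Matrix (Fin n) (Fin n) ℂ) : 0 ≤ sNorm A :=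
  norm_nonneg _

open scoped Matrix.Norms.L2Operator in
theorem sNorm_exp_aux {n : ℕ} (D : Matrix (Fin n) (Fin n) ℂ) (l d : ℝ) (hD : D.IsDiag)
    (hre : ∀ i, (D i i).re ≤ -l) (hd : 0 ≤ d) :
    sNorm (NormedSpace.exp ((d : ℂ) • D)) ≤ Real.exp (-l * d) := by
  have h1 : (d : ℂ) • D = diagonal (fun i => (d : ℂ) * D i i) := by
    ext i j
    by_cases hij : i = j
    · subst hij; simp
    · simp [hij, hD hij]
  rw [h1, Matrix.exp_diagonal]
  unfold sNorm
  rw [← Matrix.cstar_norm_def, Matrix.l2_opNorm_diagonal]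
  rw [pi_norm_le_iff_of_nonneg (Real.exp_pos _).le]
  intro i
  rw [Pi.coe_exp, ← Complex.exp_eq_exp_ℂ, Complex.norm_exp]
  apply Real.exp_le_exp.mpr
  have := mul_le_mul_of_nonneg_left (hre i) hd
  simp only [Complex.re_ofReal_mul]
  linarith

theorem prodDesc_factor_aux {n : ℕ}
    (P D : ℕ → Matrix (Fin n) (Fin n) ℂ) (lam δ : ℕ → ℝ)
    (hD : ∀ j, (D j).IsDiag)
    (hre : ∀ j i, ((D j) i i).re ≤ -lam j) (hδ : ∀ j, 0 ≤ δ j) (m : ℕ) (hm : 1 ≤ m) :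
    ∃ Q, prodDesc (fun j => P j * NormedSpace.exp ((δ j : ℂ) • D j) * (P j)⁻¹) m = P m * Q ∧
      sNorm Q ≤ sNorm ((P 1)⁻¹) *
        (∏ j ∈ Finset.Ico 1 m, sNorm ((P (j + 1))⁻¹ * P j)) *
        ∏ j ∈ Finset.Icc 1 m, Real.exp (-lam j * δ j) := by
  have hE := fun j => sNorm_exp_aux (D j) (lam j) (δ j) (hD j) (hre j) (hδ j)
  induction m, hm using Nat.le_induction with
  | base =>
    refine ⟨NormedSpace.exp ((δ 1 : ℂ) • D 1) * (P 1)⁻¹, ?_, ?_⟩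
    · simp [prodDesc, Matrix.mul_assoc]
    · refine (sNorm_mul_le_aux _ _).trans ?_
      have := mul_le_mul_of_nonneg_right (hE 1) (sNorm_nonneg_aux (P 1)⁻¹)
      simp only [Finset.Ico_self, Finset.prod_empty, Finset.Icc_self, Finset.prod_singleton]
      linarith
  | succ m hm ih =>
    obtain ⟨Q, hQ, hb⟩ := ih
    refine ⟨NormedSpace.exp ((δ (m + 1) : ℂ) • D (m + 1)) * (((P (m + 1))⁻¹ * P m) * Q), ?_, ?_⟩
    · rw [prodDesc, hQ]
      simp only [Matrix.mul_assoc]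
    · rw [Finset.prod_Ico_succ_top hm, Finset.prod_Icc_succ_top (by omega)]
      calc _ ≤ Real.exp (-lam (m + 1) * δ (m + 1)) * (sNorm ((P (m + 1))⁻¹ * P m) * _) :=
            (sNorm_mul_le_aux _ _).trans (mul_le_mul (hE _)
              ((sNorm_mul_le_aux _ _).trans (mul_le_mul_of_nonneg_left hb (sNorm_nonneg_aux _)))
              (sNorm_nonneg_aux _) (Real.exp_pos _).le)
        _ = _ := by ring

/-- the basic estimate for an ordered product
`P_m e^{D_m δ_m} P_m⁻¹ ⋯ P_1 e^{D_1 δ_1} P_1⁻¹` in the spectral norm. -/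
theorem spectral_norm_ordered_product_le {n : ℕ} (m : ℕ) (hm : 1 ≤ m)
    (P D : ℕ → Matrix (Fin n) (Fin n) ℂ) (lam δ : ℕ → ℝ)
    (hP : ∀ j, IsUnit (P j)) (hD : ∀ j, (D j).IsDiag)
    (hre : ∀ j i, ((D j) i i).re ≤ -lam j) (hδ : ∀ j, 0 ≤ δ j) :
    sNorm (prodDesc (fun j => P j * NormedSpace.exp ((δ j : ℂ) • D j) * (P j)⁻¹) m) ≤
      sNorm (P m) * sNorm ((P 1)⁻¹) *
        (∏ j ∈ Finset.Ico 1 m, sNorm ((P (j + 1))⁻¹ * P j)) *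
        ∏ j ∈ Finset.Icc 1 m, Real.exp (-lam j * δ j) := by
  obtain ⟨Q, hQ, hb⟩ := prodDesc_factor_aux P D lam δ hD hre hδ m hm
  rw [hQ]
  refine (sNorm_mul_le_aux _ _).trans ?_
  refine (mul_le_mul_of_nonneg_left hb (sNorm_nonneg_aux _)).trans (le_of_eq ?_)
  ring
end

section
/- Let A_1 be a stable and A_2 an unstable real n×n matrix, both diagonalizable over ℂ, with A_i = P_i D_i P_i⁻¹ (P_i invertible complex, D_i diagonal). Let −λ < 0 be the maximum real part of the eigenvalues of A_1 and μ > 0 the maximum real part of the eigenvalues of A_2. Let 0 = t_0 < t_1 < t_2 < ⋯ with t_m → ∞ be switching times with the alternating signal σ_m = 1 for m odd and σ_m = 2 for m even, and suppose t_m − t_{m−1} ≥ τ whenever σ_m = 1 and t_m − t_{m−1} ≤ η whenever σ_m = 2, for some τ, η > 0. If ln( ‖P_2⁻¹P_1‖ · ‖P_1⁻¹P_2‖ ) − λτ + μη < 0, then for every x_0 the solution x(t) = exp(A_{σ_m}(t − t_{m−1}))⋯exp(A_{σ_1} t_1)·x_0 (t ∈ [t_{m−1}, t_m)) satisfies ‖x(t)‖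 → 0 as t → ∞. -/
open Matrix Filter Topology Finset

attribute [local instance] Classical.propDecidable

open scoped Matrix.Norms.L2Operator in
lemma aux_exp {n : ℕ} (A : Matrix (Fin n) (Fin n) ℝ) (P D : Matrix (Fin n) (Fin n) ℂ) (a : ℝ)
    (h : Diagonalized A P D) (ha : MaxRe A a) (s : ℝ) (hs : 0 ≤ s) :
    ∃ E : Matrix (Fin n) (Fin n) ℂ,
      (NormedSpace.exp (s • A)).map Complex.ofReal = P * E * P⁻¹ ∧ ‖E‖ ≤ Real.exp (s * a) := by
  obtain ⟨hP, hD, hA⟩ := h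
  obtain ⟨d, rfl⟩ : ∃ d, D = diagonal d := ⟨D.diag, hD.diagonal_diag.symm⟩
  have hspec : ∀ i, (d i).re ≤ a := by
    intro i
    apply ha.2
    refine ⟨d i, ?_, rfl⟩
    rw [hA]
    obtain ⟨u, rfl⟩ := hP
    rw [← Matrix.coe_units_inv, spectrum.units_conjugate, spectrum_diagonal]
    exact ⟨i, rfl⟩
  refine ⟨diagonal (NormedSpace.exp ((s : ℂ) • d)), ?_, ?_⟩
  · have h1 : (NormedSpace.exp (s • A)).map Complex.ofReal
        = NormedSpace.exp ((s • A).map Complex.ofReal) := by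
      refine NormedSpace.map_exp_of_mem_ball (𝕂 := ℝ) (Complex.ofRealHom.mapMatrix :
        Matrix (Fin n) (Fin n) ℝ →+* Matrix (Fin n) (Fin n) ℂ) ?_ (s • A) ?_
      · exact Continuous.matrix_map continuous_id Complex.continuous_ofReal
      · rw [NormedSpace.expSeries_radius_eq_top]
        exact edist_lt_top _ _
    have h2 : (s • A).map Complex.ofReal = P * ((s : ℂ) • diagonal d) * P⁻¹ := by
      rw [mul_smul_comm, smul_mul_assoc, ← hA]
      ext i j
      simp
    rw [h1, h2, Matrix.exp_conj _ _ hP, ← diagonal_smul, Matrix.exp_diagonal]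
  · rw [l2_opNorm_diagonal, pi_norm_le_iff_of_nonneg (Real.exp_pos _).le]
    intro i
    rw [Pi.coe_exp, ← Complex.exp_eq_exp_ℂ, Complex.norm_exp]
    apply Real.exp_le_exp.2
    simpa using mul_le_mul_of_nonneg_left (hspec i) hs

open scoped Matrix.Norms.L2Operator in
lemma aux_norm {n : ℕ} (M : Matrix (Fin n) (Fin n) ℝ) (x : EuclideanSpace ℝ (Fin n)) :
    ‖Matrix.toEuclideanCLM (𝕜 := ℝ) M x‖ ≤ ‖M.map Complex.ofReal‖ * ‖x‖ := by
  have h := l2_opNorm_mulVec (M.map Complex.ofReal)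
    (WithLp.toLp 2 (fun i => (x i : ℂ)) : EuclideanSpace ℂ (Fin n))
  have e1 : ‖(WithLp.toLp 2 (fun i => (x i : ℂ)) : EuclideanSpace ℂ (Fin n))‖ = ‖x‖ := by
    simp [EuclideanSpace.norm_eq]
  rw [e1] at h
  refine le_trans (le_of_eq ?_) h
  simp only [EuclideanSpace.norm_eq]
  congr 1
  refine Finset.sum_congr rfl fun i _ => ?_
  congr 1
  rw [Matrix.ofLp_toEuclideanCLM]
  have : ((M.map Complex.ofReal) *ᵥ (fun i => (x i : ℂ))) i = ((M *ᵥ x.ofLp) i : ℝ) := by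
    simp [Matrix.mulVec, dotProduct]
  simp [this]

lemma aux_real {X K e e' q : ℝ} (hK : 0 ≤ K) (hq : 0 ≤ q) (he : e ≤ e')
    (h : X ≤ K * (e * q)) : X ≤ (K * e') * q := by
  rw [mul_assoc]
  exact h.trans (mul_le_mul_of_nonneg_left (mul_le_mul_of_nonneg_right he hq) hK)

lemma aux_seq_s16 (q : ℕ → ℝ) (hq : ∀ m, 0 ≤ q m) (c r : ℝ) (hr0 : 0 ≤ r) (hr : r < 1)
    (hodd : ∀ k, q (2 * k + 1) ≤ c * q (2 * k))
    (heven : ∀ k, q (2 * k + 2) ≤ r * q (2 * k)) : Tendsto q atTop (𝓝 0) := by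
  have hk : ∀ k, q (2 * k) ≤ r ^ k * q 0 := by
    intro k
    induction k with
    | zero => simp
    | succ k ih =>
      calc q (2 * (k + 1)) ≤ r * q (2 * k) := heven k
        _ ≤ r * (r ^ k * q 0) := mul_le_mul_of_nonneg_left ih hr0
        _ = _ := by ring
  have hb : ∀ m, q m ≤ (1 + |c|) * (r ^ (m / 2) * q 0) := by
    intro m
    have h0 := hk (m / 2)
    have h1 := hq (2 * (m / 2))
    rcases Nat.mod_two_eq_zero_or_one m with h | h
    · have : m = 2 * (m / 2) := by omega
      have e : q m = q (2 * (m / 2)) := by rw [← this]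
      rw [e]
      nlinarith [abs_nonneg c]
    · have : m = 2 * (m / 2) + 1 := by omega
      have e : q m = q (2 * (m / 2) + 1) := by rw [← this]
      rw [e]
      have := hodd (m / 2)
      nlinarith [abs_nonneg c, le_abs_self c]
  have ht : Tendsto (fun m : ℕ => (1 + |c|) * (r ^ (m / 2) * q 0)) atTop (𝓝 0) := by
    have h1 := (tendsto_pow_atTop_nhds_zero_of_lt_one hr0 hr).comp
      (Nat.tendsto_div_const_atTop (two_ne_zero))
    simpa using (h1.mul_const (q 0)).const_mul (1 + |c|)
  exact squeeze_zero hq hb ht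

set_option maxHeartbeats 1000000 in
open scoped Matrix.Norms.L2Operator in
theorem aux_main {n : ℕ}
    (A₁ A₂ : Matrix (Fin n) (Fin n) ℝ) (P₁ D₁ P₂ D₂ : Matrix (Fin n) (Fin n) ℂ)
    (h1 : Diagonalized A₁ P₁ D₁) (h2 : Diagonalized A₂ P₂ D₂)
    (hs : MStable A₁) (hu : MUnstable A₂)
    (lam mu : ℝ) (hlam : MaxRe A₁ (-lam)) (hmu : MaxRe A₂ mu)
    (hlam0 : 0 < lam) (hmu0 : 0 < mu)
    (τ η : ℝ) (hτ : 0 < τ) (hη : 0 < η)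
    (t : ℕ → ℝ) (ht0 : t 0 = 0) (hmono : StrictMono t) (htop : Tendsto t atTop atTop)
    (hdwell : ∀ m, m % 2 = 0 → τ ≤ t (m + 1) - t m)
    (hflee : ∀ m, m % 2 = 1 → t (m + 1) - t m ≤ η)
    (hcond : Real.log (sNorm (P₂⁻¹ * P₁) * sNorm (P₁⁻¹ * P₂)) - lam * τ + mu * η < 0) :
    AsympStable ![A₁, A₂] t (fun m => if m % 2 = 0 then (0 : Fin 2) else 1) := by
  intro x0
  set v : ℕ → Fin 2 := fun m => if m % 2 = 0 then (0 : Fin 2) else 1 with hv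
  set P : Fin 2 → Matrix (Fin n) (Fin n) ℂ := ![P₁, P₂] with hP
  set a : Fin 2 → ℝ := ![-lam, mu] with ha
  have hU : ∀ i, IsUnit (P i) := by
    intro i
    fin_cases i
    · exact h1.1
    · exact h2.1
  have hexp : ∀ i, ∀ s : ℝ, 0 ≤ s → ∃ E : Matrix (Fin n) (Fin n) ℂ,
      (NormedSpace.exp (s • ![A₁, A₂] i)).map Complex.ofReal = P i * E * (P i)⁻¹ ∧
        ‖E‖ ≤ Real.exp (s * a i) := by
    intro i s hs
    fin_cases i
    · exact aux_exp A₁ P₁ D₁ _ h1 hlam s hs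
    · exact aux_exp A₂ P₂ D₂ _ h2 hmu s hs
  have hv0 : ∀ k, v (2 * k) = 0 := fun k => by simp [hv]
  have hv1 : ∀ k, v (2 * k + 1) = 1 := fun k => by simp [hv, Nat.add_mod]
  have hmapmul : ∀ X Y : Matrix (Fin n) (Fin n) ℝ, (X * Y).map Complex.ofReal
      = X.map Complex.ofReal * Y.map Complex.ofReal := fun X Y =>
    map_mul (Complex.ofRealHom.mapMatrix) X Y
  set Q : ℕ → Matrix (Fin n) (Fin n) ℂ := fun m =>
    (P (v m))⁻¹ * (flow ![A₁, A₂] t v m).map Complex.ofReal with hQ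
  have hstep : ∀ m, ‖Q (m + 1)‖ ≤ ‖(P (v (m + 1)))⁻¹ * P (v m)‖ *
      (Real.exp ((t (m + 1) - t m) * a (v m)) * ‖Q m‖) := by
    intro m
    obtain ⟨E, hE, hEn⟩ := hexp (v m) (t (m + 1) - t m)
      (sub_nonneg.2 (hmono (Nat.lt_succ_self m)).le)
    have : Q (m + 1) = ((P (v (m + 1)))⁻¹ * P (v m)) * (E * Q m) := by
      simp only [hQ, flow]
      rw [hmapmul, hE]
      simp only [mul_assoc]
    rw [this]
    refine (norm_mul_le _ _).trans (mul_le_mul_of_nonneg_left ?_ (norm_nonneg _))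
    exact (norm_mul_le _ _).trans (mul_le_mul_of_nonneg_right hEn (norm_nonneg _))
  set K1 := ‖P₂⁻¹ * P₁‖ with hK1
  set K2 := ‖P₁⁻¹ * P₂‖ with hK2
  have hodd : ∀ k, ‖Q (2 * k + 1)‖ ≤ (K1 * Real.exp (-(lam * τ))) * ‖Q (2 * k)‖ := by
    intro k
    have h := hstep (2 * k)
    rw [hv0, hv1] at h
    have h' : Real.exp ((t (2 * k + 1) - t (2 * k)) * a 0) ≤ Real.exp (-(lam * τ)) := by
      apply Real.exp_le_exp.2
      have := hdwell (2 * k) (by omega)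
      simp only [ha, Matrix.cons_val_zero]
      nlinarith
    exact aux_real (norm_nonneg _) (norm_nonneg _) h' h
  have heven1 : ∀ k, ‖Q (2 * k + 2)‖ ≤ (K2 * Real.exp (mu * η)) * ‖Q (2 * k + 1)‖ := by
    intro k
    have h := hstep (2 * k + 1)
    rw [hv1, show 2 * k + 1 + 1 = 2 * (k + 1) by ring, hv0] at h
    have h' : Real.exp ((t (2 * (k + 1)) - t (2 * k + 1)) * a 1) ≤ Real.exp (mu * η) := by
      apply Real.exp_le_exp.2
      have := hflee (2 * k + 1) (by omega)
      rw [show 2 * k + 1 + 1 = 2 * (k + 1) by ring] at this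
      simp only [ha, Matrix.cons_val_one, Matrix.cons_val_zero]
      nlinarith
    exact aux_real (norm_nonneg _) (norm_nonneg _) h' h
  have hK1n : 0 ≤ K1 := norm_nonneg _
  have hK2n : 0 ≤ K2 := norm_nonneg _
  have hcond' : Real.log (K1 * K2) - lam * τ + mu * η < 0 := hcond
  clear_value K1 K2
  have hKpos : K1 * K2 ≤ Real.exp (Real.log (K1 * K2)) ∨ K1 * K2 = 0 := by
    rcases (mul_nonneg hK1n hK2n).eq_or_lt with h | h
    · exact Or.inr h.symm
    · exact Or.inl (Real.exp_log h).ge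
  have hr : (K2 * Real.exp (mu * η)) * (K1 * Real.exp (-(lam * τ))) < 1 := by
    have e : (K2 * Real.exp (mu * η)) * (K1 * Real.exp (-(lam * τ)))
        = (K1 * K2) * Real.exp (mu * η - lam * τ) := by
      rw [sub_eq_add_neg, Real.exp_add]; ring
    rw [e]
    rcases hKpos with h | h
    · calc _ ≤ Real.exp (Real.log (K1 * K2)) * Real.exp (mu * η - lam * τ) := by gcongr
        _ = Real.exp (Real.log (K1 * K2) - lam * τ + mu * η) := by
            rw [← Real.exp_add]; congr 1; ring
        _ < 1 := by rw [← Real.exp_zero]; exact Real.exp_lt_exp.2 hcond'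
    · rw [h, zero_mul]; exact one_pos
  have hp1 : 0 ≤ K1 * Real.exp (-(lam * τ)) := mul_nonneg hK1n (Real.exp_pos _).le
  have hp2 : 0 ≤ K2 * Real.exp (mu * η) := mul_nonneg hK2n (Real.exp_pos _).le
  have hQt : Tendsto (fun m => ‖Q m‖) atTop (𝓝 0) := by
    refine aux_seq_s16 (fun m => ‖Q m‖) (fun m => norm_nonneg _) _ _ (mul_nonneg hp2 hp1) hr hodd (fun k => ?_)
    refine (heven1 k).trans ?_
    rw [mul_assoc (K2 * Real.exp (mu * η))]
    exact mul_le_mul_of_nonneg_left (hodd k) hp2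
  set C := (‖P₁‖ + ‖P₂‖) * Real.exp (mu * η) with hC
  have hbound : ∀ m s, t m ≤ s → s < t (m + 1) →
      ‖Matrix.toEuclideanCLM (𝕜 := ℝ)
        (NormedSpace.exp ((s - t m) • ![A₁, A₂] (v m)) * flow ![A₁, A₂] t v m) x0‖
        ≤ C * ‖Q m‖ * ‖x0‖ := by
    intro m s h1s h2s
    refine (aux_norm _ _).trans (mul_le_mul_of_nonneg_right ?_ (norm_nonneg _))
    obtain ⟨E, hE, hEn⟩ := hexp (v m) (s - t m) (sub_nonneg.2 h1s)
    have e : (NormedSpace.exp ((s - t m) • ![A₁, A₂] (v m)) *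
        flow ![A₁, A₂] t v m).map Complex.ofReal = P (v m) * E * Q m := by
      rw [hmapmul, hE]
      simp only [hQ, mul_assoc]
    rw [e]
    refine (norm_mul_le _ _).trans (mul_le_mul_of_nonneg_right ?_ (norm_nonneg _))
    refine (norm_mul_le _ _).trans ?_
    have hn1 := norm_nonneg P₁
    have hn2 := norm_nonneg P₂
    rcases Nat.even_or_odd' m with ⟨k, rfl | rfl⟩
    · rw [hv0] at hEn ⊢
      have : ‖E‖ ≤ Real.exp (mu * η) := hEn.trans (Real.exp_le_exp.2 (by
        simp only [ha, Matrix.cons_val_zero]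
        nlinarith [mul_pos hmu0 hη, sub_nonneg.2 h1s]))
      refine mul_le_mul ?_ this (norm_nonneg _) (add_nonneg hn1 hn2)
      show ‖P₁‖ ≤ _
      linarith
    · rw [hv1] at hEn ⊢
      have : ‖E‖ ≤ Real.exp (mu * η) := hEn.trans (Real.exp_le_exp.2 (by
        have := hflee (2 * k + 1) (by omega)
        simp only [ha, Matrix.cons_val_one, Matrix.cons_val_zero]
        nlinarith))
      refine mul_le_mul ?_ this (norm_nonneg _) (add_nonneg hn1 hn2)
      show ‖P₂‖ ≤ _
      linarith
  have hCt : Tendsto (fun m => C * ‖Q m‖ * ‖x0‖) atTop (𝓝 0) := by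
    simpa using (hQt.const_mul C).mul_const ‖x0‖
  rw [Metric.tendsto_atTop]
  intro ε hε
  obtain ⟨N, hN⟩ := (Metric.tendsto_atTop.1 hCt) ε hε
  refine ⟨t N, fun s hs' => ?_⟩
  rw [dist_zero_right, norm_norm]
  unfold sol pc
  split_ifs with h
  · have hm := h.choose_spec
    have hle : N ≤ h.choose := by
      have := hmono.lt_iff_lt.1 (lt_of_le_of_lt hs' hm.2)
      omega
    refine (hbound _ s hm.1 hm.2).trans_lt ?_
    have := hN _ hle
    rw [dist_zero_right] at this
    exact (le_abs_self _).trans_lt this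
  · simpa using hε

/-- alternating switching between a stable subsystem `A₁` (dwell time `≥ τ`)
and an unstable subsystem `A₂` (flee time `≤ η`); if
`ln(‖P₂⁻¹P₁‖·‖P₁⁻¹P₂‖) − λτ + μη < 0` then the switched system is asymptotically stable.
(0-based: index `m` even corresponds to `σ_{m+1} = 1`.) -/
theorem stability_two_subsystems_alternating {n : ℕ}
    (A₁ A₂ : Matrix (Fin n) (Fin n) ℝ) (P₁ D₁ P₂ D₂ : Matrix (Fin n) (Fin n) ℂ)
    (h1 : Diagonalized A₁ P₁ D₁) (h2 : Diagonalized A₂ P₂ D₂)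
    (hs : MStable A₁) (hu : MUnstable A₂)
    (lam mu : ℝ) (hlam : MaxRe A₁ (-lam)) (hmu : MaxRe A₂ mu)
    (hlam0 : 0 < lam) (hmu0 : 0 < mu)
    (τ η : ℝ) (hτ : 0 < τ) (hη : 0 < η)
    (t : ℕ → ℝ) (ht0 : t 0 = 0) (hmono : StrictMono t) (htop : Tendsto t atTop atTop)
    (hdwell : ∀ m, m % 2 = 0 → τ ≤ t (m + 1) - t m)
    (hflee : ∀ m, m % 2 = 1 → t (m + 1) - t m ≤ η)
    (hcond : Real.log (sNorm (P₂⁻¹ * P₁) * sNorm (P₁⁻¹ * P₂)) - lam * τ + mu * η < 0) :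
    AsympStable ![A₁, A₂] t (fun m => if m % 2 = 0 then (0 : Fin 2) else 1) := by
  exact aux_main A₁ A₂ P₁ D₁ P₂ D₂ h1 h2 hs hu lam mu hlam hmu
    hlam0 hmu0 τ η hτ hη t ht0 hmono htop hdwell hflee hcond
end

section
/- Let A_1, A_2 be commuting real n×n matrices that are simultaneously diagonalized by a real invertible matrix P: A_1 = P·diag(α_1,…,α_n)·P⁻¹ and A_2 = P·diag(β_1,…,β_n)·P⁻¹ with all α_i, β_i real and all α_i < 0. Let 0 = t_0 < t_1 < t_2 < ⋯ with t_m → ∞ be switching times with the alternating signal σ_m = 1 for m odd and σ_m = 2 for m even, and suppose t_m − t_{m−1} ≥ τ whenever σ_m = 1 and t_m − t_{m−1} ≤ η whenever σ_m = 2, for some τ, η > 0. If α_i·τ + β_i·η < 0 for every i ∈ {1,…,n}, then for every x_0 the solution x(t) = exp(A_{σ_m}(t − t_{m−1}))⋯exp(A_{σ_1} t_1)·x_0 (t ∈ [t_{m−1}, t_m)) satisfies ‖x(t)‖ → 0 as t → ∞. -/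
open Matrix Filter Topology Finset

attribute [local instance] Classical.propDecidable

/-- Accumulated exponent of a scalar mode. -/
def modeExp (t : ℕ → ℝ) (a b : ℝ) : ℕ → ℝ
  | 0 => 0
  | m + 1 => (t (m + 1) - t m) * (if m % 2 = 0 then a else b) + modeExp t a b m

theorem modeExp_bound (t : ℕ → ℝ) (a b τ η : ℝ) (ha : a < 0) (hη : 0 < η)
    (hmono : StrictMono t)
    (hdwell : ∀ m, m % 2 = 0 → τ ≤ t (m + 1) - t m)
    (hflee : ∀ m, m % 2 = 1 → t (m + 1) - t m ≤ η) (δ : ℝ) (hδ : 0 ≤ δ)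
    (h1 : a * τ ≤ - (2 * δ)) (h2 : a * τ + b * η ≤ - (2 * δ)) (m : ℕ) :
    ∀ s, t m ≤ s → s ≤ t (m + 1) →
      (s - t m) * (if m % 2 = 0 then a else b) + modeExp t a b m ≤ - δ * m := by
  have key : ∀ d, 0 ≤ d → d ≤ η → a * τ + d * b ≤ - (2 * δ) := by
    intro d hd hd2
    rcases le_total 0 b with hb | hb
    · nlinarith
    · nlinarith
  have hodd : ∀ k : ℕ, modeExp t a b (2 * k) ≤ - δ * (2 * k : ℕ) →
      ∀ s, t (2 * k + 1) ≤ s → s ≤ t (2 * k + 1 + 1) →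
      (s - t (2 * k + 1)) * b + modeExp t a b (2 * k + 1) ≤ - δ * (2 * k + 2 : ℕ) := by
    intro k ih s hs1 hs2
    have e1 : (2 * k) % 2 = 0 := by omega
    have hd := hdwell (2 * k) e1
    have hf := hflee (2 * k + 1) (by omega)
    have hk := key (s - t (2 * k + 1)) (by linarith) (by linarith)
    simp only [modeExp, e1, if_true]
    push_cast at ih ⊢
    nlinarith
  have heven : ∀ k : ℕ, modeExp t a b (2 * k) ≤ - δ * (2 * k : ℕ) := by
    intro k
    induction k with
    | zero => simp [modeExp]
    | succ k ih =>
      have := hodd k ih (t (2 * k + 1 + 1)) (hmono (Nat.lt_succ_self _)).le le_rfl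
      have e1 : (2 * k + 1) % 2 ≠ 0 := by omega
      have e2 : 2 * (k + 1) = 2 * k + 1 + 1 := by ring
      rw [e2]
      rw [modeExp, if_neg e1]
      exact this
  intro s hs1 hs2
  rcases Nat.even_or_odd' m with ⟨k, rfl | rfl⟩
  · have e1 : (2 * k) % 2 = 0 := by omega
    rw [if_pos e1]
    have := heven k
    nlinarith
  · have e1 : (2 * k + 1) % 2 ≠ 0 := by omega
    rw [if_neg e1]
    have := hodd k (heven k) s hs1 hs2
    push_cast at this ⊢
    nlinarith

theorem exp_smul_conj_diag {n : ℕ} (P : Matrix (Fin n) (Fin n) ℝ) (hP : IsUnit P)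
    (c : Fin n → ℝ) (r : ℝ) :
    NormedSpace.exp (r • (P * Matrix.diagonal c * P⁻¹)) =
      P * Matrix.diagonal (fun i => Real.exp (r * c i)) * P⁻¹ := by
  have : r • (P * Matrix.diagonal c * P⁻¹) = P * Matrix.diagonal (r • c) * P⁻¹ := by
    rw [Matrix.diagonal_smul, Matrix.mul_smul, Matrix.smul_mul]
  rw [this, Matrix.exp_conj _ _ hP, Matrix.exp_diagonal]
  congr 3
  ext i
  rw [Pi.coe_exp, Real.exp_eq_exp_ℝ]
  simp

theorem conj_diag_mul {n : ℕ} (P : Matrix (Fin n) (Fin n) ℝ) (hP : IsUnit P)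
    (c d : Fin n → ℝ) :
    (P * Matrix.diagonal c * P⁻¹) * (P * Matrix.diagonal d * P⁻¹) =
      P * Matrix.diagonal (fun i => c i * d i) * P⁻¹ := by
  have h : P⁻¹ * P = 1 := Matrix.nonsing_inv_mul _ ((Matrix.isUnit_iff_isUnit_det _).1 hP)
  rw [← Matrix.diagonal_mul_diagonal]
  calc _ = P * Matrix.diagonal c * (P⁻¹ * P) * Matrix.diagonal d * P⁻¹ := by
        simp only [Matrix.mul_assoc]
    _ = _ := by rw [h]; simp only [Matrix.mul_assoc, Matrix.mul_one, Matrix.one_mul]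

theorem step_eq {n : ℕ} (P : Matrix (Fin n) (Fin n) ℝ) (hP : IsUnit P)
    (α β : Fin n → ℝ) (m : ℕ) (r : ℝ) :
    NormedSpace.exp (r • (![P * Matrix.diagonal α * P⁻¹, P * Matrix.diagonal β * P⁻¹] :
        Fin 2 → Matrix (Fin n) (Fin n) ℝ) (if m % 2 = 0 then (0 : Fin 2) else 1)) =
      P * Matrix.diagonal (fun i => Real.exp (r * (if m % 2 = 0 then α i else β i))) * P⁻¹ := by
  by_cases h : m % 2 = 0
  · simp only [h, if_true]
    exact exp_smul_conj_diag P hP α r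
  · simp only [h, if_false]
    exact exp_smul_conj_diag P hP β r

theorem flow_eq {n : ℕ} (P : Matrix (Fin n) (Fin n) ℝ) (hP : IsUnit P)
    (α β : Fin n → ℝ) (t : ℕ → ℝ) (m : ℕ) :
    flow ![P * Matrix.diagonal α * P⁻¹, P * Matrix.diagonal β * P⁻¹] t
      (fun m => if m % 2 = 0 then (0 : Fin 2) else 1) m =
      P * Matrix.diagonal (fun i => Real.exp (modeExp t (α i) (β i) m)) * P⁻¹ := by
  induction m with
  | zero =>
    have h : P * P⁻¹ = 1 := Matrix.mul_nonsing_inv _ ((Matrix.isUnit_iff_isUnit_det _).1 hP)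
    simp [flow, modeExp, h]
  | succ m ih =>
    rw [flow, ih, step_eq P hP, conj_diag_mul P hP]
    simp only [modeExp, Real.exp_add]

/-- commuting, simultaneously diagonalizable subsystems `A₁` (stable, dwell time
`≥ τ`) and `A₂` (flee time `≤ η`) with real eigenvalues `α_i`, `β_i`; if `α_i τ + β_i η < 0`
for every `i`, the alternating switched system is asymptotically stable. -/
theorem stability_two_commuting_subsystems {n : ℕ}
    (A₁ A₂ : Matrix (Fin n) (Fin n) ℝ) (P : Matrix (Fin n) (Fin n) ℝ) (hP : IsUnit P)
    (α β : Fin n → ℝ)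
    (h1 : A₁ = P * Matrix.diagonal α * P⁻¹) (h2 : A₂ = P * Matrix.diagonal β * P⁻¹)
    (hcomm : A₁ * A₂ = A₂ * A₁) (hα : ∀ i, α i < 0)
    (τ η : ℝ) (hτ : 0 < τ) (hη : 0 < η)
    (t : ℕ → ℝ) (ht0 : t 0 = 0) (hmono : StrictMono t) (htop : Tendsto t atTop atTop)
    (hdwell : ∀ m, m % 2 = 0 → τ ≤ t (m + 1) - t m)
    (hflee : ∀ m, m % 2 = 1 → t (m + 1) - t m ≤ η)
    (hcond : ∀ i, α i * τ + β i * η < 0) :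
    AsympStable ![A₁, A₂] t (fun m => if m % 2 = 0 then (0 : Fin 2) else 1) := by
  subst h1 h2
  intro x0
  set v : ℕ → Fin 2 := fun m => if m % 2 = 0 then (0 : Fin 2) else 1 with hv
  -- the diagonal entries of the solution operator
  let e : ℝ → Fin n → ℝ := fun s i =>
    pc t (fun m => Real.exp ((s - t m) * (if m % 2 = 0 then α i else β i)
      + modeExp t (α i) (β i) m)) 0 s
  have hsol : ∀ s, sol ![P * Matrix.diagonal α * P⁻¹, P * Matrix.diagonal β * P⁻¹] t v x0 s =
      Matrix.toEuclideanCLM (𝕜 := ℝ) (P * Matrix.diagonal (e s) * P⁻¹) x0 := by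
    intro s
    by_cases h : ∃ m, t m ≤ s ∧ s < t (m + 1)
    · simp only [sol, pc, e, dif_pos h]
      rw [flow_eq P hP, hv, step_eq P hP, conj_diag_mul P hP]
      simp only [Real.exp_add]
    · simp only [sol, pc, e, dif_neg h]
      simp
  have he : Tendsto e atTop (𝓝 0) := by
    rw [tendsto_pi_nhds]
    intro i
    obtain ⟨δ, hδ, hd1, hd2⟩ : ∃ δ : ℝ, 0 < δ ∧ α i * τ ≤ -(2 * δ) ∧
        α i * τ + β i * η ≤ -(2 * δ) := by
      have q1 : α i * τ < 0 := mul_neg_of_neg_of_pos (hα i) hτ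
      have q2 := hcond i
      refine ⟨min (-(α i * τ)) (-(α i * τ + β i * η)) / 2, ?_, ?_, ?_⟩
      · have : 0 < min (-(α i * τ)) (-(α i * τ + β i * η)) := lt_min (by linarith) (by linarith)
        linarith
      · have := min_le_left (-(α i * τ)) (-(α i * τ + β i * η))
        linarith
      · have := min_le_right (-(α i * τ)) (-(α i * τ + β i * η))
        linarith
    have hlim : Tendsto (fun N : ℕ => Real.exp (-δ * N)) atTop (𝓝 0) := by
      refine Real.tendsto_exp_atBot.comp ?_
      exact (tendsto_natCast_atTop_atTop).const_mul_atTop_of_neg (by linarith)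
    rw [Metric.tendsto_atTop]
    intro ε hε
    obtain ⟨N, hN⟩ := (hlim.eventually (gt_mem_nhds hε)).exists
    refine ⟨t N, fun s hs => ?_⟩
    rw [Pi.zero_apply, dist_zero_right]
    by_cases h : ∃ m, t m ≤ s ∧ s < t (m + 1)
    · simp only [e, pc, dif_pos h]
      obtain ⟨c1, c2⟩ := h.choose_spec
      have hb := modeExp_bound t (α i) (β i) τ η (hα i) hη hmono hdwell hflee δ hδ.le hd1 hd2
        h.choose s c1 c2.le
      have hNm : N ≤ h.choose := by
        have : N < h.choose + 1 := hmono.lt_iff_lt.1 (lt_of_le_of_lt hs c2)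
        omega
      have hNm' : (N : ℝ) ≤ (h.choose : ℝ) := by exact_mod_cast hNm
      rw [Real.norm_eq_abs, abs_of_pos (Real.exp_pos _)]
      refine lt_of_le_of_lt (Real.exp_le_exp.2 (hb.trans ?_)) hN
      nlinarith
    · simp only [e, pc, dif_neg h]
      simpa using hε
  have hcont : Continuous (fun d : Fin n → ℝ =>
      ‖Matrix.toEuclideanCLM (𝕜 := ℝ) (P * Matrix.diagonal d * P⁻¹) x0‖) := by
    let L : Matrix (Fin n) (Fin n) ℝ →ₗ[ℝ] EuclideanSpace ℝ (Fin n) :=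
      { toFun := fun M => Matrix.toEuclideanCLM (𝕜 := ℝ) M x0
        map_add' := fun M N => by simp
        map_smul' := fun r M => by simp }
    have hL : Continuous L := L.continuous_of_finiteDimensional
    have hD : Continuous (fun d : Fin n → ℝ => P * Matrix.diagonal d * P⁻¹) := by fun_prop
    exact (hL.comp hD).norm
  have := (hcont.tendsto 0).comp he
  simp only [hsol]
  simpa [Function.comp_def] using this
end
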